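/- If 2 ≤ n ≤ 6, or n ≥ 7 and n is composite, then η(n,g,g) ≥ 1 − ω(n); if n ≥ 7 and n is prime, then η(n,g,g) ≥ 1 − 2/n. -/

import Mathlib

open Polynomial

/-- The set of non-successful triples `(s, r, R)`. -/
def failSet (L : Type*) [Field L] [Algebra (ZMod 2) L] (q x : ℕ) (g : L) (D : Set L)
    (Vf : ℕ → Polynomial (ZMod 2)) (Wf : ℕ → L → Polynomial (ZMod 2)) : Set (ℕ × L × L) :=
  {t | t.1 < q ∧ (t.2.1 = 0 ∨ t.2.1 = 1) ∧ t.2.2 ∈ D ∧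
    ¬ (aeval t.2.2 (Vf t.1) ≠ 0 ∧
       aeval t.2.2 (Wf t.1 t.2.1) + (aeval t.2.2 (Vf t.1)) ^ x * (g + t.2.1) = 0)}

/-- The failure probability `ε(n,g,x,g)` = (number of non-successful triples)/(2·q·|D_x|). -/
noncomputable def epsVal (L : Type*) [Field L] [Algebra (ZMod 2) L] (q x : ℕ) (g : L)
    (D : Set L) (Vf : ℕ → Polynomial (ZMod 2)) (Wf : ℕ → L → Polynomial (ZMod 2)) : ℚ :=
  ((failSet L q x g D Vf Wf).ncard : ℚ) / ((2 * q * D.ncard : ℕ) : ℚ)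

/-- `η(n,g,g) = (1/q)·Σ_{x=0}^{q−1} ε(n,g,x,g)`. -/
noncomputable def etaVal (L : Type*) [Field L] [Algebra (ZMod 2) L] (q : ℕ) (g : L)
    (Dfam : ℕ → Set L) (Vf : ℕ → Polynomial (ZMod 2))
    (Wf : ℕ → ℕ → L → Polynomial (ZMod 2)) : ℚ :=
  (1 / (q : ℚ)) * ∑ x ∈ Finset.range q, epsVal L q x g (Dfam x) Vf (Wf x)

/-- `N₂(d)`: the number of monic irreducible polynomials of degree `d` over `GF(2)`. -/
noncomputable def N2 (d : ℕ) : ℕ :=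
  Set.ncard {P : Polynomial (ZMod 2) | P.Monic ∧ Irreducible P ∧ P.natDegree = d}

/-- The set `Φ_n` of integer tuples. -/
def PhiSet (n : ℕ) : Set (ℕ → ℕ) :=
  {z | z 1 ≤ 1 ∧ (∀ d, 1 < d → d < n → z d ≤ N2 d) ∧ 1 ≤ z n ∧ z n ≤ N2 n}

/-- `φ_n(z) = (z_1 + ⋯ + z_n)/(1·z_1 + ⋯ + n·z_n)` as a rational number. -/
def phiFn (n : ℕ) (z : ℕ → ℕ) : ℚ :=
  (∑ d ∈ Finset.Icc 1 n, (z d : ℚ)) / (∑ d ∈ Finset.Icc 1 n, (d : ℚ) * (z d : ℚ))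

/-- Polynomials over `GF(2)` commute with iterated squaring. -/
theorem aeval_pow_two_pow {L : Type*} [Field L] [Algebra (ZMod 2) L] (P : Polynomial (ZMod 2))
    (R : L) (k : ℕ) : aeval (R ^ 2 ^ k) P = aeval R P ^ 2 ^ k := by
  induction k with
  | zero => simp
  | succ k ih =>
    rw [pow_succ, pow_mul, pow_mul, ← ih, ← expand_aeval, ZMod.expand_card, map_pow]

/-- In characteristic two, iterated squaring is injective. -/
theorem pow_two_pow_injective (L : Type*) [Field L] [Algebra (ZMod 2) L] (k : ℕ) :
    Function.Injective fun a : L => a ^ 2 ^ k := by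
  have : CharP L 2 := charP_of_injective_algebraMap (algebraMap (ZMod 2) L).injective 2
  simpa [← iterateFrobenius_def] using iterateFrobenius_inj L 2 k

/-- An element of order `2 ^ n - 1` fixed by the `k`-th iterate of squaring forces
`k = 0` or `n ≤ k`. -/
theorem eq_zero_or_le_of_pow_two_pow_eq {L : Type*} [Field L] {g : L} (hg0 : g ≠ 0) {n k : ℕ}
    (hg : orderOf g = 2 ^ n - 1) (h : g ^ 2 ^ k = g) : k = 0 ∨ n ≤ k := by
  have hk : 1 ≤ 2 ^ k := Nat.one_le_two_pow
  have h1 : g ^ (2 ^ k - 1) = 1 := by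
    apply mul_right_cancel₀ hg0
    rw [← pow_succ, Nat.sub_add_cancel hk, h, one_mul]
  have hdvd := orderOf_dvd_of_pow_eq_one h1
  rw [hg] at hdvd
  rcases Nat.eq_zero_or_pos k with rfl | hpos
  · exact Or.inl rfl
  · right
    have h2 : 2 ≤ 2 ^ k := Nat.le_self_pow hpos.ne' 2
    have h3 := Nat.le_of_dvd (by omega) hdvd
    exact (Nat.pow_le_pow_iff_right (by norm_num : 1 < 2)).mp (by omega)

/-- Distinct Frobenius conjugates cannot both satisfy `W(R) + V(R) ^ x * (g + r) = 0`. -/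
theorem frobenius_shift_eq_zero {L : Type*} [Field L] [Algebra (ZMod 2) L] {g r R R' : L}
    (hg0 : g ≠ 0) {n k x : ℕ} (hg : orderOf g = 2 ^ n - 1) (hr : r = 0 ∨ r = 1)
    {V W : Polynomial (ZMod 2)} (hR : aeval R W + aeval R V ^ x * (g + r) = 0)
    (hV : aeval R' V ≠ 0) (hR' : aeval R' W + aeval R' V ^ x * (g + r) = 0)
    (hRR' : R' = R ^ 2 ^ k) (hk : k < n) : k = 0 := by
  have : CharP L 2 := charP_of_injective_algebraMap (algebraMap (ZMod 2) L).injective 2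
  have hrk : r ^ 2 ^ k = r := by rcases hr with rfl | rfl <;> simp
  have h1 : aeval R' W + aeval R' V ^ x * (g ^ 2 ^ k + r) = 0 := by
    have h2 := congrArg (iterateFrobenius L 2 k) hR
    simp only [map_add, map_mul, map_pow, map_zero, iterateFrobenius_def, hrk] at h2
    rwa [hRR', aeval_pow_two_pow, aeval_pow_two_pow]
  have h2 : aeval R' V ^ x * g ^ 2 ^ k = aeval R' V ^ x * g := by linear_combination h1 - hR'
  have h3 := mul_left_cancel₀ (pow_ne_zero x hV) h2
  rcases eq_zero_or_le_of_pow_two_pow_eq hg0 hg h3 with h | h <;> omega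

/-- The failure probability is at least `1 - 1 / n`. -/
theorem one_sub_inv_le_epsVal {L : Type*} [Field L] [Fintype L] [Algebra (ZMod 2) L]
    {n q x : ℕ} (hn : 0 < n) (hq : 0 < q) {g : L} (hg0 : g ≠ 0) (hg : orderOf g = 2 ^ n - 1)
    {D : Set L} (hD : D.Nonempty) (hclosed : ∀ R ∈ D, ∀ k : ℕ, R ^ 2 ^ k ∈ D)
    (Vf : ℕ → Polynomial (ZMod 2)) (Wf : ℕ → L → Polynomial (ZMod 2)) :
    1 - 1 / (n : ℚ) ≤ epsVal L q x g D Vf Wf := by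
  let A : Set (ℕ × L × L) := Set.Iio q ×ˢ (({0, 1} : Set L) ×ˢ D)
  have hAfin : A.Finite := (Set.finite_Iio q).prod (Set.toFinite _)
  let F := failSet L q x g D Vf Wf
  have hFA : F ⊆ A := by
    rintro ⟨s, r, R⟩ ⟨h1, h2, h3, -⟩
    exact ⟨h1, h2, h3⟩
  have hAcard : A.ncard = 2 * q * D.ncard := by
    simp only [A, Set.ncard_prod, Set.ncard_pair (zero_ne_one : (0 : L) ≠ 1)]
    rw [Set.ncard_eq_toFinset_card', Set.toFinset_Iio, Nat.card_Iio]
    ring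
  have hsum : (A \ F).ncard + F.ncard = A.ncard := Set.ncard_sdiff_add_ncard_of_subset hFA hAfin
  have hinj : ((A \ F) ×ˢ Set.Iio n).ncard ≤ A.ncard := by
    apply Set.ncard_le_ncard_of_injOn (fun t => (t.1.1, t.1.2.1, t.1.2.2 ^ 2 ^ t.2)) _ _ hAfin
    · rintro ⟨⟨s, r, R⟩, j⟩ ⟨⟨⟨hs, hr, hR⟩, -⟩, -⟩
      exact ⟨hs, hr, hclosed R hR j⟩
    · have key : ∀ s r R R' i j, (s, r, R) ∈ A \ F → (s, r, R') ∈ A \ F → i ≤ j → j < n →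
          R ^ 2 ^ i = R' ^ 2 ^ j → R = R' ∧ i = j := by
        rintro s r R R' i j ⟨⟨hs, hr, hR⟩, hRF⟩ ⟨⟨-, -, hR'⟩, hRF'⟩ hij hj heq
        have hS : aeval R (Vf s) ≠ 0 ∧
            aeval R (Wf s r) + aeval R (Vf s) ^ x * (g + r) = 0 := by
          by_contra h
          exact hRF ⟨hs, hr, hR, h⟩
        have hS' : aeval R' (Vf s) ≠ 0 ∧
            aeval R' (Wf s r) + aeval R' (Vf s) ^ x * (g + r) = 0 := by
          by_contra h
          exact hRF' ⟨hs, hr, hR', h⟩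
        have hshift : R = R' ^ 2 ^ (j - i) := by
          apply pow_two_pow_injective L i
          simp only
          rw [heq, ← pow_mul, ← pow_add, Nat.sub_add_cancel hij]
        have hzero := frobenius_shift_eq_zero hg0 hg hr hS'.2 hS.1 hS.2 hshift (by omega)
        rw [hzero] at hshift
        exact ⟨by simpa using hshift, by omega⟩
      rintro ⟨⟨s, r, R⟩, i⟩ ⟨h1, hi⟩ ⟨⟨s', r', R'⟩, j⟩ ⟨h2, hj⟩ heq
      simp only [Prod.mk.injEq] at heq
      obtain ⟨rfl, rfl, heq⟩ := heq
      rcases le_total i j with hij | hij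
      · obtain ⟨rfl, rfl⟩ := key _ _ _ _ _ _ h1 h2 hij hj heq
        rfl
      · obtain ⟨rfl, rfl⟩ := key _ _ _ _ _ _ h2 h1 hij hi heq.symm
        rfl
  rw [Set.ncard_prod, Set.ncard_eq_toFinset_card' (Set.Iio n), Set.toFinset_Iio,
    Nat.card_Iio] at hinj
  have hApos : 0 < A.ncard := by
    have : 0 < D.ncard := (Set.ncard_pos (Set.toFinite D)).mpr hD
    rw [hAcard]
    positivity
  have hsumQ : ((A \ F).ncard : ℚ) + F.ncard = A.ncard := by exact_mod_cast hsum
  have hinjQ : ((A \ F).ncard : ℚ) * n ≤ A.ncard := by exact_mod_cast hinj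
  have hAposQ : (0 : ℚ) < A.ncard := by exact_mod_cast hApos
  have hnQ : (0 : ℚ) < n := by exact_mod_cast hn
  change _ ≤ (F.ncard : ℚ) / ((2 * q * D.ncard : ℕ) : ℚ)
  rw [← hAcard, ← hsumQ, le_div_iff₀ (by rwa [hsumQ]), hsumQ]
  have : ((A \ F).ncard : ℚ) ≤ A.ncard / n := (le_div_iff₀ hnQ).mpr hinjQ
  calc (1 - 1 / (n : ℚ)) * A.ncard = A.ncard - A.ncard / n := by ring
    _ ≤ F.ncard := by linarith

/-- A generator of `GF(2 ^ n)ˣ` witnesses an irreducible polynomial of degree `n`. -/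
theorem one_le_N2 {L : Type*} [Field L] [Fintype L] [Algebra (ZMod 2) L] {n : ℕ}
    (hcard : Fintype.card L = 2 ^ n) {g : L} (hg0 : g ≠ 0) (hg : orderOf g = 2 ^ n - 1) :
    1 ≤ N2 n := by
  have : Module.Finite (ZMod 2) L := Module.Finite.of_finite
  have hint : IsIntegral (ZMod 2) g := Algebra.IsIntegral.isIntegral g
  have hrank : Module.finrank (ZMod 2) L = n := by
    have h := Module.card_eq_pow_finrank (K := ZMod 2) (V := L)
    rw [hcard, ZMod.card] at h
    exact (Nat.pow_right_injective le_rfl h).symm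
  have hdeg : (minpoly (ZMod 2) g).natDegree = n := by
    apply le_antisymm (hrank ▸ minpoly.natDegree_le g)
    let E := IntermediateField.adjoin (ZMod 2) {g}
    have : Fintype E := Fintype.ofFinite E
    have hE := Module.card_eq_pow_finrank (K := ZMod 2) (V := E)
    rw [IntermediateField.adjoin.finrank hint, ZMod.card] at hE
    have hpow := FiniteField.pow_card (⟨g, IntermediateField.mem_adjoin_simple_self _ g⟩ : E)
    rw [hE] at hpow
    have hfix : g ^ 2 ^ (minpoly (ZMod 2) g).natDegree = g := congrArg Subtype.val hpow
    have hpos := minpoly.natDegree_pos hint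
    rcases eq_zero_or_le_of_pow_two_pow_eq hg0 hg hfix with h | h <;> omega
  have hfin : {P : Polynomial (ZMod 2) | P.Monic ∧ Irreducible P ∧ P.natDegree = n}.Finite := by
    have : Finite (degreeLT (ZMod 2) (n + 1)) :=
      Finite.of_equiv _ (degreeLTEquiv (ZMod 2) (n + 1)).symm.toEquiv
    apply (Set.toFinite (degreeLT (ZMod 2) (n + 1) : Set (Polynomial (ZMod 2)))).subset
    rintro P ⟨-, -, hP⟩
    rw [SetLike.mem_coe, mem_degreeLT]
    exact degree_le_natDegree.trans_lt (by rw [hP]; exact_mod_cast n.lt_succ_self)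
  exact (Set.ncard_pos hfin).mpr
    ⟨_, minpoly.monic hint, minpoly.irreducible hint, hdeg⟩

/-- The value `1 / n` is attained by `phiFn n` on `PhiSet n`. -/
theorem inv_mem_phiFn_image {n : ℕ} (hn : 2 ≤ n) (hN : 1 ≤ N2 n) :
    1 / (n : ℚ) ∈ phiFn n '' PhiSet n := by
  refine ⟨fun d => if d = n then 1 else 0, ⟨?_, ?_, ?_, ?_⟩, ?_⟩
  · simp [show 1 ≠ n by omega]
  · intro d _ hd
    simp [hd.ne]
  · simp
  · simpa using hN
  · simp [phiFn, show 1 ≤ n by omega]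

/-- If `2 ≤ n ≤ 6`, or `n ≥ 7` and `n` is composite, then `η(n,g,g) ≥ 1 − ω(n)`;
if `n ≥ 7` and `n` is prime, then `η(n,g,g) ≥ 1 − 2/n`. -/
theorem stmt15 {L : Type*} [Field L] [Fintype L] [Algebra (ZMod 2) L]
    (n : ℕ) (hn : 2 ≤ n) (hcard : Fintype.card L = 2 ^ n)
    (g : L) (hg : orderOf g = 2 ^ n - 1)
    (Y : ℕ → Polynomial (ZMod 2))
    (hY : ∀ x < 2 ^ n - 1, (Y x).degree < (n : WithBot ℕ) ∧ aeval g (Y x) = g ^ x)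
    (Dfam : ℕ → Set L)
    (hDfam : ∀ x, Dfam x = {β : L | β ≠ 0 ∧ aeval β (Y x) = β ^ x})
    (Vf : ℕ → Polynomial (ZMod 2))
    (hVf : ∀ s < 2 ^ n - 1, (Vf s).degree < (n : WithBot ℕ) ∧ aeval g (Vf s) = g ^ s)
    (Wf : ℕ → ℕ → L → Polynomial (ZMod 2))
    (hWf : ∀ x < 2 ^ n - 1, ∀ s < 2 ^ n - 1, ∀ r : L, (r = 0 ∨ r = 1) →
      (Wf x s r).degree < (n : WithBot ℕ) ∧ aeval g (Wf x s r) = g ^ (x * s) * (g + r))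
    (ω : ℚ) (hω : IsGreatest (phiFn n '' PhiSet n) ω) :
    (((2 ≤ n ∧ n ≤ 6) ∨ (7 ≤ n ∧ ¬ n.Prime)) →
        etaVal L (2 ^ n - 1) g Dfam Vf Wf ≥ 1 - ω) ∧
      ((7 ≤ n ∧ n.Prime) →
        etaVal L (2 ^ n - 1) g Dfam Vf Wf ≥ 1 - 2 / (n : ℚ)) := by
  have hpow : 2 ≤ 2 ^ n := Nat.le_self_pow (by omega) 2
  have hq : 0 < 2 ^ n - 1 := by omega
  have hg0 : g ≠ 0 := by
    rintro rfl
    rw [orderOf_zero] at hg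
    omega
  have hnQ : (0 : ℚ) < n := by exact_mod_cast (by omega : 0 < n)
  have hη : 1 - 1 / (n : ℚ) ≤ etaVal L (2 ^ n - 1) g Dfam Vf Wf := by
    have hqQ : (0 : ℚ) < ((2 ^ n - 1 : ℕ) : ℚ) := by exact_mod_cast hq
    have hε : ∀ x ∈ Finset.range (2 ^ n - 1),
        1 - 1 / (n : ℚ) ≤ epsVal L (2 ^ n - 1) x g (Dfam x) Vf (Wf x) := by
      intro x hx
      refine one_sub_inv_le_epsVal (by omega) hq hg0 hg ⟨g, ?_⟩ ?_ Vf (Wf x)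
      · rw [hDfam]
        exact ⟨hg0, (hY x (Finset.mem_range.mp hx)).2⟩
      · rw [hDfam]
        rintro R ⟨hR0, hR⟩ k
        exact ⟨pow_ne_zero _ hR0, by rw [aeval_pow_two_pow, hR, pow_right_comm]⟩
    have hsum := Finset.card_nsmul_le_sum _ _ _ hε
    rw [Finset.card_range, nsmul_eq_mul] at hsum
    rw [etaVal, one_div_mul_eq_div, le_div_iff₀ hqQ, mul_comm]
    exact hsum
  have hω' : 1 / (n : ℚ) ≤ ω := hω.2 (inv_mem_phiFn_image hn (one_le_N2 hcard hg0 hg))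
  have hle : 1 / (n : ℚ) ≤ 2 / n := by gcongr; norm_num
  exact ⟨fun _ => by linarith, fun _ => by linarith⟩
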